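/- One-dimensional fractional identity for an odd profile: for x ∈ (-1,1), the function u(x) = x(1-x²)^{1/2} (extended by 0 outside (-1,1)) satisfies (-Δ)^{1/2} u(x) = 2x for all x ∈ (-1,1). -/

import Mathlib

open Real MeasureTheory

noncomputable def gG (a y : ℝ) : ℝ :=
  -((a+y) * √(1-(a+y)^2)) / y + 2 * √(1-(a+y)^2) - 2*a*arcsin (a+y)
   - (1-2*a^2)/√(1-a^2) * (log (1 - a*(a+min y (1-a)) + √(1-a^2) * √(1-(a+min y (1-a))^2)) - log (min y (1-a)))

lemma Dpos (a t : ℝ) (ha : -1 < a) (ha' : a < 1) (h1 : -1 ≤ t) (h2 : t ≤ 1) :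
    0 < 1 - a*t + √(1-a^2) * √(1-t^2) := by
  have : 0 ≤ √(1-a^2) * √(1-t^2) := by positivity
  nlinarith [mul_nonneg (sub_nonneg.2 h2) (sub_nonneg.2 ha'.le), mul_nonneg (sub_nonneg.2 h1) (sub_nonneg.2 ha'.le), mul_nonneg (sub_nonneg.2 h2) (sub_nonneg.2 ha.le), mul_nonneg (sub_nonneg.2 h1) (sub_nonneg.2 ha.le)]

lemma sder (a y : ℝ) (h1 : -1 < a + y) (h2 : a + y < 1) :
    HasDerivAt (fun y => √(1-(a+y)^2)) (-(a+y)/√(1-(a+y)^2)) y := by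
  have hp : 0 < 1-(a+y)^2 := by nlinarith
  have h : HasDerivAt (fun y : ℝ => 1-(a+y)^2) (-(2*(a+y))) y := by
    have := (((hasDerivAt_id y).const_add a).pow 2).const_sub 1
    refine this.congr_deriv ?_
    simp
  refine (h.sqrt hp.ne').congr_deriv ?_
  have : √(1-(a+y)^2) ≠ 0 := (sqrt_pos.2 hp).ne'
  field_simp

lemma gder1 (a y : ℝ) (ha : -1 < a) (ha' : a < 1) (hy : 0 < y) (hy' : y < 1 - a) :
    HasDerivAt (gG a) ((a+y) * √(1-(a+y)^2) / y^2) y := by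
  have h1 : -1 < a + y := by linarith
  have h2 : a + y < 1 := by linarith
  have hs := sder a y h1 h2
  have hp : 0 < 1-(a+y)^2 := by nlinarith
  have hq : 0 < 1-a^2 := by nlinarith
  have hD := Dpos a (a+y) ha ha' h1.le h2.le
  have hid : HasDerivAt (fun y => a + y) 1 y := (hasDerivAt_id y).const_add a
  have hA := (hasDerivAt_arcsin h1.ne' h2.ne).comp y hid
  have hD' : HasDerivAt (fun y => 1 - a*(a+y) + √(1-a^2) * √(1-(a+y)^2)) 
     (-a + √(1-a^2) * (-(a+y)/√(1-(a+y)^2))) y := by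
    refine (((hid.const_mul a).const_sub 1).add (hs.const_mul _)).congr_deriv ?_
    simp
  have key := ((((hid.mul hs).neg.div (hasDerivAt_id y) hy.ne').add (hs.const_mul 2)).sub (hA.const_mul (2*a))).sub
    (((hD'.log hD.ne').sub (hasDerivAt_log hy.ne')).const_mul ((1-2*a^2)/√(1-a^2)))
  refine (key.congr_of_eventuallyEq (f₁ := gG a) ?_).congr_deriv ?_
  · filter_upwards [Iio_mem_nhds hy'] with z hz
    have : min z (1-a) = z := min_eq_left (le_of_lt hz)
    simp only [gG, this]
    exact rfl
  simp only [id, Pi.mul_apply, Pi.neg_apply]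
  have hS := sqrt_pos.2 hp
  have hSA := sqrt_pos.2 hq
  have e1 := sq_sqrt hp.le
  have e2 := sq_sqrt hq.le
  set S := √(1-(a+y)^2)
  set A := √(1-a^2)
  have k1 : (-a + A * (-(a+y)/S)) / (1 - a*(a+y) + A*S) - y⁻¹ = - A / (S*y) := by
    have hD2 := hD.ne'
    have e3 : (-a + A * (-(a+y)/S)) = (-a * S - A * (a+y)) / S := by field_simp; ring
    rw [e3, div_div, inv_eq_one_div, div_sub_div _ _ (by positivity) hy.ne', div_eq_div_iff (by positivity) (by positivity)]
    linear_combination (-S*A*y) * e1 + S^2*y * e2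
  rw [k1]
  field_simp
  linear_combination (-y) * e1

lemma gder2 (a y : ℝ) (ha : -1 < a) (ha' : a < 1) (hy' : 1 - a < y) :
    HasDerivAt (gG a) ((a+y) * √(1-(a+y)^2) / y^2) y := by
  have h0 : ∀ z, 1 - a < z → √(1-(a+z)^2) = 0 := fun z hz => sqrt_eq_zero_of_nonpos (by nlinarith)
  rw [h0 y hy']
  have heq : gG a =ᶠ[nhds y] fun _ => gG a y := by
    filter_upwards [Ioi_mem_nhds hy'] with z hz
    have : min z (1-a) = 1-a := min_eq_right (le_of_lt hz)
    have h3 : min y (1-a) = 1-a := min_eq_right (le_of_lt hy')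
    have hz' : 1 - a < z := hz
    simp only [gG, this, h3, h0 y hy', h0 z hz, arcsin_of_one_le (show 1 ≤ a + z by linarith), arcsin_of_one_le (show 1 ≤ a + y by linarith)]
    simp
  refine ((hasDerivAt_const y (gG a y)).congr_of_eventuallyEq heq).congr_deriv (by simp)

lemma gval (a y : ℝ) (ha : -1 < a) (ha' : a < 1) (hy' : 1 - a < y) : gG a y = -(a * π) := by
  have h0 : √(1-(a+y)^2) = 0 := sqrt_eq_zero_of_nonpos (by nlinarith)
  have h3 : min y (1-a) = 1-a := min_eq_right (le_of_lt hy')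
  simp only [gG, h3, h0, arcsin_of_one_le (show 1 ≤ a + y by linarith)]
  simp
  ring

lemma gcont (a y : ℝ) (ha : -1 < a) (ha' : a < 1) (hy : 0 < y) : ContinuousAt (gG a) y := by
  have hm : 0 < min y (1-a) := lt_min hy (by linarith)
  have hD := Dpos a (a+min y (1-a)) ha ha' (by linarith) (by linarith [min_le_right y (1-a)])
  have := hy.ne'
  have := hm.ne'
  have := hD.ne'
  unfold gG
  fun_prop (disch := assumption)

noncomputable def vv (t : ℝ) : ℝ := t * √(1-t^2)

lemma vneg (t : ℝ) : vv (-t) = - vv t := by simp [vv]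

lemma vcont : Continuous vv := by unfold vv; fun_prop

lemma vder (x : ℝ) (h1 : -1 < x) (h2 : x < 1) :
    HasDerivAt vv (√(1-x^2) + x * (-x / √(1-x^2))) x := by
  have := (hasDerivAt_id x).mul (sder 0 x (by simpa using h1) (by simpa using h2))
  simp only [zero_add, id, one_mul] at this
  exact this

lemma vbound (t : ℝ) : |vv t| ≤ 1 := by
  by_cases h : t^2 ≤ 1
  · have h1 : |t| ≤ 1 := by rwa [← sq_le_one_iff_abs_le_one]
    have h2 : |√(1-t^2)| ≤ 1 := by
      rw [abs_of_nonneg (sqrt_nonneg _)]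
      exact sqrt_le_one.2 (by nlinarith [sq_nonneg t])
    rw [vv, abs_mul]
    exact mul_le_one₀ h1 (abs_nonneg _) h2
  · rw [vv, sqrt_eq_zero_of_nonpos (by linarith)]; simp

noncomputable def rr (a y : ℝ) : ℝ := 2 * √(1-(a+y)^2) - 2*a*arcsin (a+y)
   - (1-2*a^2)/√(1-a^2) * (log (1 - a*(a+y) + √(1-a^2) * √(1-(a+y)^2)))

lemma rcont (a : ℝ) (ha : -1 < a) (ha' : a < 1) : ContinuousAt (rr a) 0 := by
  have hD := (Dpos a (a+0) ha ha' (by linarith) (by linarith)).ne'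
  unfold rr
  fun_prop (disch := assumption)

lemma r0 (x : ℝ) : - rr x 0 + rr (-x) 0 = 0 := by
  simp [rr]

noncomputable def Phi (x y : ℝ) : ℝ := -2 * vv x / y - gG x y + gG (-x) y

lemma Phi_lim (x : ℝ) (h1 : -1 < x) (h2 : x < 1) :
    Filter.Tendsto (Phi x) (nhdsWithin 0 (Set.Ioi 0)) (nhds 0) := by
  have hle : nhdsWithin (0:ℝ) (Set.Ioi 0) ≤ nhdsWithin 0 {0}ᶜ :=
    nhdsWithin_mono _ (fun y hy => ne_of_gt hy)
  have d1 := (hasDerivAt_iff_tendsto_slope_zero.1 (vder x h1 h2)).mono_left hle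
  have d2 := (hasDerivAt_iff_tendsto_slope_zero.1 (vder (-x) (by linarith) (by linarith))).mono_left hle
  have c1 := (rcont x h1 h2).tendsto.mono_left (nhdsWithin_le_nhds (s := Set.Ioi 0))
  have c2 := (rcont (-x) (by linarith) (by linarith)).tendsto.mono_left (nhdsWithin_le_nhds (s := Set.Ioi 0))
  have key := (d1.sub d2).add (c1.neg.add c2)
  rw [r0] at key
  have : (√(1-x^2) + x * (-x / √(1-x^2))) - (√(1-(-x)^2) + (-x) * (-(-x) / √(1-(-x)^2))) + 0 = 0 := by
    simp; ring
  rw [this] at key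
  refine key.congr' ?_
  filter_upwards [self_mem_nhdsWithin, nhdsWithin_le_nhds (Iio_mem_nhds (show 0 < 1 - x by linarith)),
    nhdsWithin_le_nhds (Iio_mem_nhds (show 0 < 1 - (-x) by linarith))] with y hy hy1 hy2
  have e1 : min y (1-x) = y := min_eq_left (le_of_lt hy1)
  have e2 : min y (1-(-x)) = y := min_eq_left (le_of_lt hy2)
  simp only [Phi, gG, e1, e2, rr, vneg, smul_eq_mul]
  simp only [vv, neg_sq]
  ring

lemma Phi_der (x y : ℝ) (h1 : -1 < x) (h2 : x < 1) (hy : 0 < y) (n1 : y ≠ 1 - x) (n2 : y ≠ 1 + x) :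
    HasDerivAt (Phi x) ((2 * vv x - vv (x+y) - vv (x-y)) / y^2) y := by
  have g : ∀ a, -1 < a → a < 1 → y ≠ 1 - a → HasDerivAt (gG a) (vv (a+y) / y^2) y := by
    intro a ha ha' hn
    rcases lt_or_gt_of_ne hn with h | h
    · exact gder1 a y ha ha' hy h
    · exact gder2 a y ha ha' h
  have g1 := g x h1 h2 n1
  have g2 := g (-x) (by linarith) (by linarith) (by simpa using n2)
  have k := (((hasDerivAt_const y (-2 * vv x)).div (hasDerivAt_id y) hy.ne').sub g1).add g2
  refine HasDerivAt.congr_deriv k ?_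
  have : vv (x - y) = - vv (-x + y) := by rw [← vneg]; congr 1; ring
  rw [this]
  simp only [id]
  ring

lemma Phi_cont (x R : ℝ) (h1 : -1 < x) (h2 : x < 1) :
    ContinuousOn (Function.update (Phi x) 0 0) (Set.Icc 0 R) := by
  intro y hy
  rcases hy.1.eq_or_lt with h | h
  · rw [← h, continuousWithinAt_update_same]
    refine (Phi_lim x h1 h2).mono_left (nhdsWithin_mono _ ?_)
    intro z hz
    exact lt_of_le_of_ne hz.1.1 (fun h => hz.2 h.symm)
  · refine ContinuousAt.continuousWithinAt ?_
    rw [continuousAt_update_of_ne h.ne']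
    have c1 := gcont x y h1 h2 h
    have c2 := gcont (-x) y (by linarith) (by linarith) h
    have := h.ne'
    unfold Phi
    fun_prop (disch := assumption)

lemma near (x : ℝ) (h1 : -1 < x) (h2 : x < 1) : ∃ δ > 0, ∃ C, ∀ y ∈ Set.Icc 0 δ,
    ‖2 * vv x - vv (x+y) - vv (x-y)‖ ≤ C * y^2 := by
  obtain ⟨δ, hδ, k1, k2⟩ : ∃ δ > 0, δ < 1 - x ∧ δ < 1 + x := by
    refine ⟨min (1-x) (1+x) / 2, ?_, ?_, ?_⟩
    · have : 0 < min (1-x) (1+x) := lt_min (by linarith) (by linarith)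
      linarith
    · linarith [min_le_left (1-x) (1+x)]
    · linarith [min_le_right (1-x) (1+x)]
  refine ⟨δ, hδ, ?_⟩
  have hc : ContDiffOn ℝ ((1:ℕ) + 1) (fun y => 2 * vv x - vv (x+y) - vv (x-y)) (Set.Icc 0 δ) := by
    intro y hy
    have p1 : 1 - (x+y)^2 ≠ 0 := by nlinarith [hy.1, hy.2]
    have p2 : 1 - (x-y)^2 ≠ 0 := by nlinarith [hy.1, hy.2]
    refine ContDiffAt.contDiffWithinAt ?_
    unfold vv
    fun_prop (disch := assumption)
  have hd : HasDerivAt (fun y => 2 * vv x - vv (x+y) - vv (x-y)) 0 0 := by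
    have hv := vder x h1 h2
    have a1 : HasDerivAt (fun y => vv (x+y)) _ 0 :=
      HasDerivAt.comp_const_add x 0 (by simpa using hv)
    have a2 : HasDerivAt (fun y => vv (x-y)) _ 0 :=
      HasDerivAt.comp_const_sub x 0 (by simpa using hv)
    refine ((a1.const_sub (2 * vv x)).sub a2).congr_deriv (by ring)
  obtain ⟨C, hC⟩ := exists_taylor_mean_remainder_bound hδ.le hc
  refine ⟨C, fun y hy => ?_⟩
  have := hC y hy
  have hw := hd.hasDerivWithinAt.derivWithin (uniqueDiffOn_Icc hδ 0 ⟨le_rfl, hδ.le⟩)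
  rw [taylorWithinEval_succ, taylor_within_zero_eval, zero_add, iteratedDerivWithin_one, hw] at this
  simpa [two_mul] using this

lemma integ (x : ℝ) (h1 : -1 < x) (h2 : x < 1) :
    IntegrableOn (fun y => (2 * vv x - vv (x+y) - vv (x-y)) / y^2) (Set.Ioi 0) := by
  obtain ⟨δ, hδ, C, hC⟩ := near x h1 h2
  have hm : Measurable (fun y => (2 * vv x - vv (x+y) - vv (x-y)) / y^2) := by
    have := vcont.measurable
    fun_prop
  rw [← Set.Ioc_union_Ioi_eq_Ioi hδ.le]
  refine IntegrableOn.union ?_ ?_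
  · refine Measure.integrableOn_of_bounded (M := C) (by simp) hm.aestronglyMeasurable ?_
    refine (ae_restrict_iff' measurableSet_Ioc).2 (Filter.Eventually.of_forall fun y hy => ?_)
    have hy0 : 0 < y := hy.1
    rw [norm_div, norm_of_nonneg (by positivity : 0 ≤ y^2), div_le_iff₀ (by positivity)]
    exact hC y ⟨hy.1.le, hy.2⟩
  · have h4 := (integrableOn_Ioi_rpow_of_lt (show (-2:ℝ) < -1 by norm_num) hδ).const_mul 4
    refine Integrable.mono' h4 hm.aestronglyMeasurable ?_
    refine (ae_restrict_iff' measurableSet_Ioi).2 (Filter.Eventually.of_forall fun y hy => ?_)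
    have hy0 : 0 < y := hδ.trans hy
    have e : y ^ (-2:ℝ) = (y^2)⁻¹ := by
      rw [rpow_neg hy0.le]; norm_cast
    rw [e, ← div_eq_mul_inv, norm_div, norm_of_nonneg (by positivity : 0 ≤ y^2)]
    gcongr
    rw [norm_eq_abs, abs_le]
    have b1 := abs_le.1 (vbound x)
    have b2 := abs_le.1 (vbound (x+y))
    have b3 := abs_le.1 (vbound (x-y))
    constructor <;> linarith [b1.1, b1.2, b2.1, b2.2, b3.1, b3.2]

lemma val (x : ℝ) (h1 : -1 < x) (h2 : x < 1) :
    ∫ y in Set.Ioi 0, (2 * vv x - vv (x+y) - vv (x-y)) / y^2 = 2 * π * x := by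
  have hi := integ x h1 h2
  have t := intervalIntegral_tendsto_integral_Ioi 0 hi Filter.tendsto_id
  refine tendsto_nhds_unique t ?_
  have t2 : Filter.Tendsto (fun R : ℝ => -2 * vv x / R + 2 * π * x) Filter.atTop (nhds (0 + 2 * π * x)) :=
    (Filter.Tendsto.const_div_atTop Filter.tendsto_id _).add_const _
  rw [zero_add] at t2
  refine t2.congr' ?_
  filter_upwards [Filter.eventually_gt_atTop 2] with R hR
  have hR0 : 0 < R := by linarith
  have := integral_eq_of_hasDerivAt_off_countable_of_le (Function.update (Phi x) 0 0)
    (fun y => (2 * vv x - vv (x+y) - vv (x-y)) / y^2) hR0.le (s := {1-x, 1+x})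
    (Set.to_countable _) (Phi_cont x R h1 h2) (by
      rintro y ⟨hy, hn⟩
      simp only [Set.mem_insert_iff, Set.mem_singleton_iff, not_or] at hn
      refine (Phi_der x y h1 h2 hy.1 hn.1 hn.2).congr_of_eventuallyEq ?_
      filter_upwards [Ioi_mem_nhds hy.1] with z hz
      exact Function.update_of_ne (ne_of_gt hz) _ _)
    ((intervalIntegrable_iff_integrableOn_Ioc_of_le hR0.le).2 (hi.mono_set (fun y hy => hy.1)))
  simp only [id]
  rw [this, Function.update_self, Function.update_of_ne hR0.ne', Phi,
    gval x R h1 h2 (by linarith), gval (-x) R (by linarith) (by linarith) (by linarith)]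
  ring

/-- the odd profile `u(x) = x(1-x²)₊^{1/2}` satisfies
`(-Δ)^{1/2} u(x) = 2x` on `(-1,1)`, with the half-Laplacian given by the
finite-difference singular integral `(1/π) ∫_ℝ (2u(x)-u(x+y)-u(x-y))/(2y²) dy`. -/
theorem stmt_10 (u : ℝ → ℝ) (hu : ∀ x : ℝ, u x = x * Real.sqrt (max (1 - x^2) 0)) :
    ∀ x ∈ Set.Ioo (-1:ℝ) 1,
      (1/Real.pi) * ∫ y : ℝ, (2 * u x - u (x+y) - u (x-y)) / (2 * y^2) = 2 * x := by
  intro x hx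
  have hv : ∀ t, u t = vv t := by
    intro t
    rw [hu, vv]
    congr 1
    rcases le_total (1 - t^2) 0 with h | h
    · rw [max_eq_right h, sqrt_eq_zero_of_nonpos h, sqrt_zero]
    · rw [max_eq_left h]
  have e : ∀ y : ℝ, (2 * u x - u (x+y) - u (x-y)) / (2 * y^2)
      = (fun z => (2 * vv x - vv (x+z) - vv (x-z)) / z^2) |y| * (1/2) := by
    intro y
    simp only [hv, sq_abs]
    rcases abs_choice y with h | h <;> rw [h]
    · ring
    · rw [sub_neg_eq_add, ← sub_eq_add_neg]; ring
  simp_rw [e]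
  rw [integral_mul_const,
    integral_comp_abs (f := fun z => (2 * vv x - vv (x+z) - vv (x-z)) / z^2), val x hx.1 hx.2]
  field_simp
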